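/- Let Ψ be an m×n complex matrix whose Gram matrix ΨᴴΨ is positive definite, let r ∈ ℂᵐ, define α̂₁ := (ΨᴴΨ)⁻¹ Ψᴴ r, let μ ∈ ℂⁿ be nonzero, set c := μᴴ(ΨᴴΨ)⁻¹μ (a positive real number), and define α̂₀ := α̂₁ − ((ΨᴴΨ)⁻¹ μ)·(μᴴ α̂₁)/c. Then ‖r − Ψ α̂₀‖² − ‖r − Ψ α̂₁‖² = |μᴴ α̂₁|² / c. -/

import Mathlib

open Matrix
open scoped ComplexOrder

/-- Squared Euclidean norm of a complex vector. -/
def sqnorm {m : ℕ} (v : Fin m → ℂ) : ℝ := ∑ i, Complex.normSq (v i)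

/-- The unconstrained least-squares (ML) estimate `α̂₁ := (ΨᴴΨ)⁻¹ Ψᴴ r`. -/
noncomputable def alphaHat1 {m n : ℕ} (Ψ : Matrix (Fin m) (Fin n) ℂ) (r : Fin m → ℂ) :
    Fin n → ℂ :=
  (Ψᴴ * Ψ)⁻¹ *ᵥ (Ψᴴ *ᵥ r)

/-- The constrained ML estimate `α̂₀ := α̂₁ − ((ΨᴴΨ)⁻¹ μ)·(μᴴ α̂₁)/c` with
`c := μᴴ(ΨᴴΨ)⁻¹μ`. -/
noncomputable def alphaHat0 {m n : ℕ} (Ψ : Matrix (Fin m) (Fin n) ℂ) (r : Fin m → ℂ)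
    (μ : Fin n → ℂ) : Fin n → ℂ :=
  alphaHat1 Ψ r -
    ((star μ ⬝ᵥ alphaHat1 Ψ r) / (star μ ⬝ᵥ (Ψᴴ * Ψ)⁻¹ *ᵥ μ)) • ((Ψᴴ * Ψ)⁻¹ *ᵥ μ)

theorem sqnorm_eq_re_dotProduct {m : ℕ} (v : Fin m → ℂ) : sqnorm v = (star v ⬝ᵥ v).re := by
  simp [sqnorm, dotProduct, Complex.normSq_apply]

theorem sqnorm_add_of_dotProduct_eq_zero {m : ℕ} (v w : Fin m → ℂ) (h : star w ⬝ᵥ v = 0) :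
    sqnorm (v + w) = sqnorm v + sqnorm w := by
  have h' : star v ⬝ᵥ w = 0 := by
    rw [← star_star w, star_dotProduct_star, h, star_zero]
  simp [sqnorm_eq_re_dotProduct, add_dotProduct, dotProduct_add, h, h']

theorem sqnorm_smul {m : ℕ} (t : ℂ) (v : Fin m → ℂ) :
    sqnorm (t • v) = Complex.normSq t * sqnorm v := by
  simp [sqnorm, Finset.mul_sum]

theorem star_mulVec_dotProduct {m n : ℕ} (A : Matrix (Fin m) (Fin n) ℂ) (x : Fin n → ℂ)
    (v : Fin m → ℂ) : star (A *ᵥ x) ⬝ᵥ v = star x ⬝ᵥ (Aᴴ *ᵥ v) := by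
  rw [star_mulVec, dotProduct_mulVec]

/-- The normal equations: the least-squares residual is orthogonal to the columns of `Ψ`. -/
theorem conjTranspose_mulVec_residual {m n : ℕ} (Ψ : Matrix (Fin m) (Fin n) ℂ)
    (hΨ : IsUnit (Ψᴴ * Ψ).det) (r : Fin m → ℂ) :
    Ψᴴ *ᵥ (r - Ψ *ᵥ alphaHat1 Ψ r) = 0 := by
  rw [alphaHat1, mulVec_sub, mulVec_mulVec, mulVec_mulVec, mul_nonsing_inv _ hΨ, one_mulVec,
    sub_self]

theorem sqnorm_mulVec_gram_inv {m n : ℕ} (Ψ : Matrix (Fin m) (Fin n) ℂ)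
    (hΨ : IsUnit (Ψᴴ * Ψ).det) (μ : Fin n → ℂ) :
    sqnorm (Ψ *ᵥ ((Ψᴴ * Ψ)⁻¹ *ᵥ μ)) = (star μ ⬝ᵥ (Ψᴴ * Ψ)⁻¹ *ᵥ μ).re := by
  have hG : ((Ψᴴ * Ψ)⁻¹)ᴴ = (Ψᴴ * Ψ)⁻¹ := (isHermitian_conjTranspose_mul_self Ψ).inv
  rw [sqnorm_eq_re_dotProduct, star_mulVec_dotProduct, mulVec_mulVec, mulVec_mulVec,
    mul_nonsing_inv _ hΨ, one_mulVec, star_mulVec_dotProduct, hG]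

/-- The GLRT statistic identity: the difference of the constrained and unconstrained
least-squares residuals equals `|μᴴ α̂₁|² / c`, where `c := μᴴ(ΨᴴΨ)⁻¹μ` is a positive
real number. -/
theorem residual_difference_eq {m n : ℕ} (Ψ : Matrix (Fin m) (Fin n) ℂ)
    (hΨ : (Ψᴴ * Ψ).PosDef) (r : Fin m → ℂ) (μ : Fin n → ℂ) (hμ : μ ≠ 0) :
    sqnorm (r - Ψ *ᵥ alphaHat0 Ψ r μ) - sqnorm (r - Ψ *ᵥ alphaHat1 Ψ r) =
      Complex.normSq (star μ ⬝ᵥ alphaHat1 Ψ r) / (star μ ⬝ᵥ (Ψᴴ * Ψ)⁻¹ *ᵥ μ).re := by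
  have hdet : IsUnit (Ψᴴ * Ψ).det := (isUnit_iff_isUnit_det _).mp hΨ.isUnit
  obtain ⟨hre, him⟩ := Complex.pos_iff.mp (hΨ.inv.dotProduct_mulVec_pos hμ)
  have hres := conjTranspose_mulVec_residual Ψ hdet r
  have hsq := sqnorm_mulVec_gram_inv Ψ hdet μ
  rw [alphaHat0]
  set c := star μ ⬝ᵥ (Ψᴴ * Ψ)⁻¹ *ᵥ μ
  set g := (Ψᴴ * Ψ)⁻¹ *ᵥ μ
  set s := star μ ⬝ᵥ alphaHat1 Ψ r
  have horth : star ((s / c) • Ψ *ᵥ g) ⬝ᵥ (r - Ψ *ᵥ alphaHat1 Ψ r) = 0 := by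
    rw [← mulVec_smul, star_mulVec_dotProduct, hres, dotProduct_zero]
  have hc : Complex.normSq c = c.re * c.re := by
    rw [Complex.normSq_apply, ← him, mul_zero, add_zero]
  rw [mulVec_sub, mulVec_smul, ← sub_add, sqnorm_add_of_dotProduct_eq_zero _ _ horth,
    add_sub_cancel_left, sqnorm_smul, hsq, Complex.normSq_div, hc]
  field_simp
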